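/- Let V be a finite ground set with marginals p_i ∈ [0,1], let C be a nonempty finite set of feasible decisions, and suppose for every x ∈ C the function f(x,·) : 2^V → ℝ is non-decreasing, satisfies f(x,∅) ≥ 0, and admits an (η,β)-cost-sharing scheme. If x_I ∈ C minimizes the independent expected cost I(f(x,·),V,{p_i}) over x ∈ C, then L(f(x_I,·),V,{p_i}) ≤ η·β·(e/(e−1))·min_{x∈C} L(f(x,·),V,{p_i}); i.e., solving the stochastic optimization problem under the independent distribution yields an ηβe/(e−1)-approximate solution to the correlation-robust optimization problem. -/

import Mathlib

open Finset

variable {W : Type*} [Fintype W] [DecidableEq W]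

/-- Expected value of `f` under a distribution `α` on subsets of the ground set. -/
noncomputable def expVal (α : Finset W → ℝ) (f : Finset W → ℝ) : ℝ :=
  ∑ S : Finset W, α S * f S

/-- `α` is a probability distribution on subsets of the ground set with marginals `p`. -/
def IsDistWithMarginals (p : W → ℝ) (α : Finset W → ℝ) : Prop :=
  (∀ S, 0 ≤ α S) ∧ (∑ S : Finset W, α S = 1) ∧
    (∀ i : W, ∑ S ∈ Finset.univ.filter (fun S => i ∈ S), α S = p i)

/-- The worst-case expected value `L(f,V,{p_i})`: supremum of the expected value of `f`
over all distributions with marginals `p`. -/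
noncomputable def worstVal (p : W → ℝ) (f : Finset W → ℝ) : ℝ :=
  sSup {v | ∃ α, IsDistWithMarginals p α ∧ v = expVal α f}

/-- The expected value `I(f,V,{p_i})` of `f` when each element is included
independently with probability `p i`. -/
noncomputable def indepVal (p : W → ℝ) (f : Finset W → ℝ) : ℝ :=
  ∑ S : Finset W, (∏ i ∈ S, p i) * (∏ i ∈ Sᶜ, (1 - p i)) * f S

/-- `χ` is an `(η,β)`-cost-sharing scheme for `f`.  An ordering of a subset `S` of the ground
set is encoded as a duplicate-free list `l` with `l.toFinset = S`; the restriction of the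
ordering `l` to a subset `s` is `l.filter (· ∈ s)`.  The three conditions are:
`β`-budget balance, cross-monotonicity, and weak `η`-summability (the sum over `ℓ` of the
share of the `ℓ`-th element in the set of the first `ℓ` elements is at most `η·f(S)`). -/
def IsCostShare (f : Finset W → ℝ) (η β : ℝ) (χ : List W → W → ℝ) : Prop :=
  (∀ l : List W, l ≠ [] → l.Nodup →
      ∑ i ∈ l.toFinset, χ l i ≤ f l.toFinset ∧ f l.toFinset / β ≤ ∑ i ∈ l.toFinset, χ l i) ∧
  (∀ l : List W, l.Nodup → ∀ s : Finset W, s ⊆ l.toFinset → ∀ i ∈ s,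
      χ l i ≤ χ (l.filter (fun a => a ∈ s)) i) ∧
  (∀ l : List W, l ≠ [] → l.Nodup →
      ∑ ℓ : Fin l.length, χ (l.take (ℓ.1 + 1)) (l.get ℓ) ≤ η * f l.toFinset)

/-- Expectation of `g` over a random subset of `U` containing each `i ∈ U` independently with
probability `x i`. -/
noncomputable def bernExp {V : Type*} [DecidableEq V] (U : Finset V) (x : V → ℝ)
    (g : Finset V → ℝ) : ℝ :=
  ∑ T ∈ U.powerset, (∏ i ∈ T, x i) * (∏ i ∈ U \ T, (1 - x i)) * g T

lemma indepVal_eq_bernExp {V : Type*} [Fintype V] [DecidableEq V] (x : V → ℝ)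
    (g : Finset V → ℝ) : indepVal x g = bernExp univ x g := by
  simp [indepVal, bernExp, Finset.compl_eq_univ_sdiff]

lemma bernExp_empty {V : Type*} [DecidableEq V] (x : V → ℝ) (g : Finset V → ℝ) :
    bernExp ∅ x g = g ∅ := by
  simp [bernExp]

lemma bernExp_insert {V : Type*} [DecidableEq V] {U : Finset V} {k : V} (hk : k ∉ U)
    (x : V → ℝ) (g : Finset V → ℝ) :
    bernExp (insert k U) x g
      = (1 - x k) * bernExp U x g + x k * bernExp U x (fun T => g (insert k T)) := by
  unfold bernExp
  rw [Finset.sum_powerset_insert hk, Finset.mul_sum, Finset.mul_sum]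
  congr 1
  · refine Finset.sum_congr rfl fun T hT => ?_
    have hT' := Finset.mem_powerset.1 hT
    have hkT : k ∉ T := fun h => hk (hT' h)
    rw [Finset.insert_sdiff_of_notMem _ hkT, Finset.prod_insert (by simp [hk])]
    ring
  · refine Finset.sum_congr rfl fun T hT => ?_
    have hT' := Finset.mem_powerset.1 hT
    have hkT : k ∉ T := fun h => hk (hT' h)
    rw [Finset.insert_sdiff_insert, Finset.sdiff_insert_of_notMem hk, Finset.prod_insert hkT]
    ring

lemma bernExp_const {V : Type*} [DecidableEq V] (U : Finset V) (x : V → ℝ) (c : ℝ) :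
    bernExp U x (fun _ => c) = c := by
  induction U using Finset.induction_on with
  | empty => simp [bernExp_empty]
  | insert k U hk ih => rw [bernExp_insert hk, ih]; ring

lemma bernExp_mono_right {V : Type*} [DecidableEq V] (U : Finset V) {x : V → ℝ}
    (hx : ∀ i, 0 ≤ x i ∧ x i ≤ 1) {g h : Finset V → ℝ} (hgh : ∀ T, g T ≤ h T) :
    bernExp U x g ≤ bernExp U x h := by
  refine Finset.sum_le_sum fun T _ => mul_le_mul_of_nonneg_left (hgh T) ?_
  exact mul_nonneg (Finset.prod_nonneg fun i _ => (hx i).1)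
    (Finset.prod_nonneg fun i _ => sub_nonneg.2 (hx i).2)

lemma bernExp_mono_left {V : Type*} [DecidableEq V] (U : Finset V) {x y : V → ℝ}
    (hx : ∀ i, 0 ≤ x i ∧ x i ≤ 1) (hy : ∀ i, 0 ≤ y i ∧ y i ≤ 1) (hxy : ∀ i, x i ≤ y i)
    {g : Finset V → ℝ} (hg : Monotone g) : bernExp U x g ≤ bernExp U y g := by
  induction U using Finset.induction_on generalizing g with
  | empty => simp [bernExp_empty]
  | insert k U hk ih =>
    rw [bernExp_insert hk, bernExp_insert hk]
    have h0 := ih hg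
    have h1 : bernExp U x (fun T => g (insert k T)) ≤ bernExp U y (fun T => g (insert k T)) :=
      ih fun S T hST => hg (Finset.insert_subset_insert k hST)
    have h2 : bernExp U y g ≤ bernExp U y (fun T => g (insert k T)) :=
      bernExp_mono_right U hy fun T => hg (Finset.subset_insert k T)
    nlinarith [mul_nonneg (sub_nonneg.2 (hx k).2) (sub_nonneg.2 h0),
      mul_nonneg (hx k).1 (sub_nonneg.2 h1), mul_nonneg (sub_nonneg.2 (hxy k)) (sub_nonneg.2 h2)]

lemma bernExp_zero {V : Type*} [DecidableEq V] (U : Finset V) (g : Finset V → ℝ) :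
    bernExp U (fun _ => 0) g = g ∅ := by
  induction U using Finset.induction_on with
  | empty => simp [bernExp_empty]
  | insert k U hk ih => rw [bernExp_insert hk, ih]; ring

/-- Kolmogorov's equation for the random set of elements whose independent exponential clocks
with rates `p i` have rung before time `t`. -/
lemma hasDerivAt_bernExp {V : Type*} [DecidableEq V] (U : Finset V) (p : V → ℝ)
    (g : Finset V → ℝ) (t : ℝ) :
    HasDerivAt (fun t => bernExp U (fun i => 1 - Real.exp (-(p i * t))) g)
      (∑ j ∈ U, p j * (bernExp U (fun i => 1 - Real.exp (-(p i * t))) (fun T => g (insert j T))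
        - bernExp U (fun i => 1 - Real.exp (-(p i * t))) g)) t := by
  induction U using Finset.induction_on generalizing g with
  | empty => simpa [bernExp_empty] using hasDerivAt_const t (g ∅)
  | insert k U hk ih =>
    have he : HasDerivAt (fun t => Real.exp (-(p k * t))) (-(p k * Real.exp (-(p k * t)))) t := by
      have h : HasDerivAt (fun t => -(p k * t)) (-(p k)) t := by
        simpa using ((hasDerivAt_id' t).const_mul (p k)).fun_neg
      simpa [mul_comm] using h.exp
    have h1 := ih g
    have h2 := ih (fun T => g (insert k T))
    have h3 := (he.mul h1).add ((he.const_sub 1).mul h2)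
    have hfun : (fun t => bernExp (insert k U) (fun i => 1 - Real.exp (-(p i * t))) g)
        = (fun t => Real.exp (-(p k * t)) * bernExp U (fun i => 1 - Real.exp (-(p i * t))) g
          + (1 - Real.exp (-(p k * t)))
            * bernExp U (fun i => 1 - Real.exp (-(p i * t))) (fun T => g (insert k T))) := by
      funext s
      rw [bernExp_insert hk]
      ring
    rw [hfun]
    refine h3.congr_deriv ?_
    rw [Finset.sum_insert hk]
    simp only [bernExp_insert hk, Finset.insert_idem]
    have hsum : ∀ x : V → ℝ, ∑ j ∈ U, p j * ((1 - x k) * bernExp U x (fun T => g (insert j T))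
          + x k * bernExp U x (fun T => g (insert j (insert k T)))
          - ((1 - x k) * bernExp U x g + x k * bernExp U x (fun T => g (insert k T))))
        = (1 - x k) * ∑ j ∈ U, p j * (bernExp U x (fun T => g (insert j T)) - bernExp U x g)
          + x k * ∑ j ∈ U, p j * (bernExp U x (fun T => g (insert k (insert j T)))
            - bernExp U x (fun T => g (insert k T))) := by
      intro x
      rw [Finset.mul_sum, Finset.mul_sum, ← Finset.sum_add_distrib]
      refine Finset.sum_congr rfl fun j _ => ?_
      simp only [Finset.insert_comm k j]
      ring
    have := hsum (fun i => 1 - Real.exp (-(p i * t)))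
    rw [this]
    ring

/-- Comparison principle for the scalar equation `v' = s - q v`. -/
lemma le_of_linear_ode {v y s y' : ℝ → ℝ} {q : ℝ}
    (hv : ∀ t, HasDerivAt v (s t - q * v t) t) (hy : ∀ t, HasDerivAt y (y' t) t)
    (hle : ∀ t, 0 ≤ t → y' t ≤ s t - q * y t) (h0 : y 0 ≤ v 0) :
    ∀ t, 0 ≤ t → y t ≤ v t := by
  have hd : ∀ t, HasDerivAt (fun t => Real.exp (q * t) * (v t - y t))
      (Real.exp (q * t) * (s t - q * y t - y' t)) t := by
    intro t
    have he : HasDerivAt (fun t => Real.exp (q * t)) (Real.exp (q * t) * q) t := by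
      simpa using ((hasDerivAt_id t).const_mul q).exp
    refine (he.mul ((hv t).sub (hy t))).congr_deriv ?_
    simp only [Pi.sub_apply]
    ring
  have hmono : MonotoneOn (fun t => Real.exp (q * t) * (v t - y t)) (Set.Ici 0) := by
    refine monotoneOn_of_deriv_nonneg (convex_Ici 0)
      (fun t _ => (hd t).continuousAt.continuousWithinAt)
      (fun t _ => (hd t).differentiableAt.differentiableWithinAt) fun t ht => ?_
    rw [interior_Ici] at ht
    rw [(hd t).deriv]
    exact mul_nonneg (Real.exp_pos _).le (by linarith [hle t (le_of_lt ht)])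
  intro t ht
  have h := hmono (Set.mem_Ici.2 le_rfl) (Set.mem_Ici.2 ht) ht
  simp only [mul_zero, Real.exp_zero, one_mul] at h
  by_contra hlt
  push Not at hlt
  nlinarith [mul_pos (Real.exp_pos (q * t)) (sub_pos.2 hlt)]

/-- The sum of the shares paid by the elements of `l` on arrival. -/
noncomputable def arrivalCost {V : Type*} (χ : List V → V → ℝ) (l : List V) : ℝ :=
  ∑ ℓ : Fin l.length, χ (l.take (ℓ.1 + 1)) (l.get ℓ)

lemma arrivalCost_append_singleton {V : Type*} (χ : List V → V → ℝ) (l : List V) (i : V) :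
    arrivalCost χ (l ++ [i]) = arrivalCost χ l + χ (l ++ [i]) i := by
  have key : ∀ (m : List V), arrivalCost χ m
      = ∑ k ∈ Finset.range m.length, if h : k < m.length then χ (m.take (k + 1)) m[k] else 0 := by
    intro m
    rw [Finset.sum_range]
    simp [arrivalCost]
  have hlen : (l ++ [i]).length = l.length + 1 := by simp
  rw [key, key, show Finset.range (l ++ [i]).length = Finset.range (l.length + 1) by rw [hlen],
    Finset.sum_range_succ]
  congr 1
  · refine Finset.sum_congr rfl fun k hk => ?_
    have hk' := Finset.mem_range.1 hk
    rw [dif_pos hk', dif_pos (by simp; omega), List.getElem_append_left hk',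
      List.take_append_of_le_length (by omega)]
  · simp [List.take_of_length_le]

lemma filter_mem_of_prefix {V : Type*} [DecidableEq V] {l r : List V} (h : (l ++ r).Nodup) :
    (l ++ r).filter (fun a => a ∈ l.toFinset) = l := by
  rw [List.filter_append]
  have h1 : l.filter (fun a => decide (a ∈ l.toFinset)) = l := by
    rw [List.filter_eq_self]; intro a ha; simpa using ha
  have h2 : r.filter (fun a => decide (a ∈ l.toFinset)) = [] := by
    rw [List.filter_eq_nil_iff]
    intro a ha
    have := List.disjoint_of_nodup_append h
    simpa using fun hl => this hl ha
  rw [h1, h2, List.append_nil]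

lemma sum_share_le_arrivalCost {V : Type*} [DecidableEq V] {χ : List V → V → ℝ}
    (hχ : ∀ l : List V, l.Nodup → ∀ s : Finset V, s ⊆ l.toFinset → ∀ i ∈ s,
      χ l i ≤ χ (l.filter (fun a => a ∈ s)) i) (l r : List V) (h : (l ++ r).Nodup) :
    ∑ i ∈ l.toFinset, χ (l ++ r) i ≤ arrivalCost χ l := by
  induction l using List.reverseRecOn generalizing r with
  | nil => simp [arrivalCost]
  | append_singleton l i ih =>
    have hli : i ∉ l := by
      have := (List.nodup_append.1 h).1
      simp [List.nodup_append] at this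
      intro hi
      exact this.2 i hi rfl
    rw [arrivalCost_append_singleton]
    have hset : (l ++ [i]).toFinset = insert i l.toFinset := by ext; simp
    rw [hset, Finset.sum_insert (by simpa using hli)]
    have h1 : χ (l ++ [i] ++ r) i ≤ χ (l ++ [i]) i := by
      have := hχ _ h (l ++ [i]).toFinset
        (by intro a; simp only [List.mem_toFinset, List.mem_append]; tauto) i (by simp)
      rwa [filter_mem_of_prefix h] at this
    have h2 := ih (i :: r) (by simpa using h)
    have h3 : l ++ [i] ++ r = l ++ i :: r := by simp
    rw [h3] at h1 ⊢
    linarith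

lemma drift_single {V : Type*} [Fintype V] [DecidableEq V] {f : Finset V → ℝ}
    {η β : ℝ} (hβ : 1 ≤ β) (hmono : Monotone f) {χ : List V → V → ℝ} (hχ : IsCostShare f η β χ)
    {l : List V} (hl : l.Nodup) {A : Finset V} (hA : A.Nonempty) :
    f A / β - arrivalCost χ l ≤ ∑ i ∈ A \ l.toFinset, χ (l ++ [i]) i := by
  obtain ⟨hbud, hcm, -⟩ := hχ
  set r := (A \ l.toFinset).toList with hr
  have hnd : (l ++ r).Nodup := by
    rw [List.nodup_append]
    refine ⟨hl, Finset.nodup_toList _, ?_⟩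
    rintro a ha b hb rfl
    simp [hr] at hb
    exact hb.2 ha
  have hset : (l ++ r).toFinset = l.toFinset ∪ A := by
    rw [List.toFinset_append, hr, Finset.toList_toFinset, Finset.union_sdiff_self_eq_union]
  have hne : l ++ r ≠ [] := by
    intro h0
    have : (l ++ r).toFinset = ∅ := by rw [h0]; rfl
    rw [hset, Finset.union_eq_empty] at this
    exact hA.ne_empty this.2
  have h1 := (hbud _ hne hnd).2
  rw [hset] at h1
  have h2 : f A / β ≤ f (l.toFinset ∪ A) / β :=
    div_le_div_of_nonneg_right (hmono Finset.subset_union_right) (by linarith)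
  have h3 := sum_share_le_arrivalCost hcm l r hnd
  have h4 : ∑ i ∈ l.toFinset ∪ A, χ (l ++ r) i
      = ∑ i ∈ l.toFinset, χ (l ++ r) i + ∑ i ∈ A \ l.toFinset, χ (l ++ r) i := by
    rw [← Finset.sum_union Finset.disjoint_sdiff, Finset.union_sdiff_self_eq_union]
  have h5 : ∑ i ∈ A \ l.toFinset, χ (l ++ r) i ≤ ∑ i ∈ A \ l.toFinset, χ (l ++ [i]) i := by
    refine Finset.sum_le_sum fun i hi => ?_
    have hir : i ∈ r := by simpa [hr] using hi
    have hil : i ∉ l := by simpa using (Finset.mem_sdiff.1 hi).2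
    have := hcm _ hnd (insert i l.toFinset) (by
      intro a ha
      rcases Finset.mem_insert.1 ha with rfl | ha
      · simp [hir]
      · simp at ha; simp [ha]) i (by simp)
    refine this.trans_eq ?_
    congr 1
    rw [List.filter_append]
    congr 1
    · rw [List.filter_eq_self]
      intro a ha
      simp [ha]
    · have hrn : r.Nodup := Finset.nodup_toList _
      have : r.filter (fun a => decide (a ∈ insert i l.toFinset)) = r.filter (fun a => a == i) := by
        refine List.filter_congr fun a ha => ?_
        have : a ∉ l := by
          have : a ∈ A \ l.toFinset := by simpa [hr] using ha
          simpa using (Finset.mem_sdiff.1 this).2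
        simp [this, Bool.beq_eq_decide_eq]
      rw [this, List.filter_beq, List.count_eq_one_of_mem hrn hir]
      rfl
  linarith

lemma sum_marginals {V : Type*} [Fintype V] [DecidableEq V] {p : V → ℝ} {α : Finset V → ℝ}
    (hα : IsDistWithMarginals p α) (U : Finset V) (c : V → ℝ) :
    ∑ i ∈ U, p i * c i = ∑ A, α A * ∑ i ∈ A ∩ U, c i := by
  have h1 : ∀ i, p i * c i = ∑ A, if i ∈ A then α A * c i else 0 := by
    intro i
    rw [← hα.2.2 i, Finset.sum_mul, Finset.sum_filter]
  rw [Finset.sum_congr rfl fun i _ => h1 i, Finset.sum_comm]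
  refine Finset.sum_congr rfl fun A _ => ?_
  rw [Finset.mul_sum, ← Finset.sum_filter, Finset.inter_comm, Finset.filter_mem_eq_inter]

lemma drift_le {V : Type*} [Fintype V] [DecidableEq V] {p : V → ℝ} {α : Finset V → ℝ}
    (hα : IsDistWithMarginals p α) {f : Finset V → ℝ}
    {η β : ℝ} (hβ : 1 ≤ β) (hmono : Monotone f) {χ : List V → V → ℝ} (hχ : IsCostShare f η β χ)
    {l : List V} (hl : l.Nodup) :
    ∑ A ∈ univ.erase ∅, α A * (f A / β) - (∑ A ∈ univ.erase ∅, α A) * arrivalCost χ l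
      ≤ ∑ i ∈ univ \ l.toFinset, p i * χ (l ++ [i]) i := by
  rw [sum_marginals hα, Finset.sum_mul, ← Finset.sum_sub_distrib,
    ← Finset.add_sum_erase univ _ (Finset.mem_univ ∅)]
  simp only [Finset.empty_inter, Finset.sum_empty, mul_zero, zero_add]
  refine Finset.sum_le_sum fun A hA => ?_
  rw [← mul_sub]
  refine mul_le_mul_of_nonneg_left ?_ (hα.1 A)
  have := drift_single hβ hmono hχ hl
    (Finset.nonempty_iff_ne_empty.2 (Finset.ne_of_mem_erase hA))
  rwa [← Finset.inter_sdiff_assoc, Finset.inter_univ]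

lemma one_sub_exp_neg_ge_chord {θ : ℝ} (h0 : 0 ≤ θ) (h1 : θ ≤ 1) :
    (1 - Real.exp (-1)) * θ ≤ 1 - Real.exp (-θ) := by
  have h := convexOn_exp.2 (Set.mem_univ (-1 : ℝ)) (Set.mem_univ (0 : ℝ)) h0
    (sub_nonneg.2 h1) (by ring)
  simp only [smul_eq_mul, mul_zero, add_zero, mul_neg, mul_one, Real.exp_zero] at h
  linarith

lemma exp_neg_tangent {k c P : ℝ} (hk : 0 ≤ k) (hkc : k * Real.exp c ≤ 1) :
    k * (1 + c) ≤ Real.exp (-P) + k * P := by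
  have h1 := Real.add_one_le_exp (c - P)
  have h2 : Real.exp (c - P) = Real.exp c * Real.exp (-P) := by
    rw [← Real.exp_add, sub_eq_add_neg]
  have h3 := mul_le_mul_of_nonneg_left h1 hk
  have h4 := mul_le_mul_of_nonneg_right hkc (Real.exp_pos (-P)).le
  rw [h2] at h3
  linarith

lemma exp_neg_one_bounds : 0.3678 < Real.exp (-1) ∧ Real.exp (-1) < 0.3680 := by
  have h1 := Real.exp_one_gt_d9
  have h2 := Real.exp_one_lt_d9
  have h3 : Real.exp (-1) * Real.exp 1 = 1 := by rw [← Real.exp_add]; norm_num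
  have h4 := Real.exp_pos (-1)
  constructor <;> nlinarith

lemma exp_three_half_lt : Real.exp (3 / 2) < 4.6 := by
  have h : Real.exp (3 / 2) ^ 2 = Real.exp 1 ^ 3 := by
    rw [← Real.exp_nat_mul, ← Real.exp_nat_mul]; norm_num
  have h3 : Real.exp 1 ^ 3 < 2.7182818286 ^ 3 :=
    pow_lt_pow_left₀ Real.exp_one_lt_d9 (Real.exp_pos _).le (by norm_num)
  refine lt_of_pow_lt_pow_left₀ 2 (by norm_num) ?_
  rw [h]
  refine h3.trans ?_
  norm_num

lemma exp_five_quarter_lt : Real.exp (5 / 4) < 3.54 := by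
  have h : Real.exp (5 / 4) ^ 4 = Real.exp 1 ^ 5 := by
    rw [← Real.exp_nat_mul, ← Real.exp_nat_mul]; norm_num
  have h3 : Real.exp 1 ^ 5 < 2.7182818286 ^ 5 :=
    pow_lt_pow_left₀ Real.exp_one_lt_d9 (Real.exp_pos _).le (by norm_num)
  refine lt_of_pow_lt_pow_left₀ 4 (by norm_num) ?_
  rw [h]
  refine h3.trans ?_
  norm_num

lemma exp_le_quadratic {s : ℝ} (h0 : 0 ≤ s) (h1 : s ≤ 1) :
    Real.exp s ≤ 1 + s + 0.719 * s ^ 2 := by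
  have h := Real.exp_bound' h0 h1 (n := 6) (by norm_num)
  simp only [Finset.sum_range_succ, Finset.sum_range_zero, Nat.factorial] at h
  norm_num at h
  have h3 : s ^ 3 ≤ s ^ 2 := pow_le_pow_of_le_one h0 h1 (by norm_num)
  have h4 : s ^ 4 ≤ s ^ 2 := pow_le_pow_of_le_one h0 h1 (by norm_num)
  have h5 : s ^ 5 ≤ s ^ 2 := pow_le_pow_of_le_one h0 h1 (by norm_num)
  have h6 : s ^ 6 ≤ s ^ 2 := pow_le_pow_of_le_one h0 h1 (by norm_num)
  have h2 : 0 ≤ s ^ 2 := sq_nonneg s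
  norm_num
  linarith

lemma one_sub_exp_neg_ge_quadratic {θ : ℝ} (h0 : 0.17 ≤ θ) (h1 : θ ≤ 1) :
    (1 - Real.exp (-1)) * θ + 0.26 * (θ * (1 - θ)) ≤ 1 - Real.exp (-θ) := by
  obtain ⟨s, rfl⟩ : ∃ s, θ = 1 - s := ⟨1 - θ, by ring⟩
  have hs0 : 0 ≤ s := by linarith
  have hs1 : s ≤ 0.83 := by norm_num at h0 ⊢; linarith
  have hq := exp_le_quadratic hs0 (by norm_num at hs1 ⊢; linarith)
  have he : Real.exp (-(1 - s)) = Real.exp (-1) * Real.exp s := by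
    rw [← Real.exp_add]; congr 1; ring
  have hE := Real.exp_pos (-1)
  obtain ⟨-, hE2⟩ : 0.3678 < Real.exp (-1) ∧ Real.exp (-1) < 0.36788 := by
    have h1 := Real.exp_one_gt_d9
    have h3 : Real.exp (-1) * Real.exp 1 = 1 := by rw [← Real.exp_add]; norm_num
    exact ⟨exp_neg_one_bounds.1, by nlinarith⟩
  have h3 := mul_le_mul_of_nonneg_left hq hE.le
  rw [he]
  norm_num at *
  nlinarith [mul_nonneg hs0 (sub_nonneg.2 hs1), mul_nonneg hs0 (sub_nonneg.2 hE2.le),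
    mul_nonneg (mul_nonneg hs0 hs0) (sub_nonneg.2 hE2.le)]

lemma one_sub_exp_neg_ge_small {θ : ℝ} (h0 : 0 ≤ θ) (h1 : θ ≤ 0.17) :
    (1 - Real.exp (-1)) * θ + 0.282 * θ ≤ 1 - Real.exp (-θ) := by
  have h := Real.quadratic_le_exp_of_nonneg h0
  have hE := exp_neg_one_bounds.1
  have h3 : Real.exp (-θ) * Real.exp θ = 1 := by rw [← Real.exp_add]; simp
  have h4 := Real.exp_pos (-θ)
  have h5 : Real.exp (-θ) ≤ 1 - θ + θ ^ 2 / 2 := by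
    by_contra hlt
    push Not at hlt
    have : (1 - θ + θ ^ 2 / 2) * (1 + θ + θ ^ 2 / 2) < 1 := by
      nlinarith [mul_le_mul_of_nonneg_left h h4.le, sq_nonneg θ]
    nlinarith [sq_nonneg (θ ^ 2)]
  norm_num at *
  nlinarith

lemma kink_inequality {θ P : ℝ} (h0 : 0 ≤ θ) (h1 : θ ≤ 1) (hP : 0 ≤ P) :
    (1 - Real.exp (-1)) * θ * (1 + P - θ) ≤ θ * Real.exp (-P) + P * (1 - Real.exp (-θ)) := by
  have hE := exp_neg_one_bounds.1
  have hE' := exp_neg_one_bounds.2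
  suffices h : ∃ δ, (1 - Real.exp (-1)) * θ + δ * θ ≤ 1 - Real.exp (-θ) ∧
      (1 - Real.exp (-1)) * (1 - θ) ≤ Real.exp (-P) + δ * P by
    obtain ⟨δ, h2, h3⟩ := h
    nlinarith [mul_le_mul_of_nonneg_left h2 hP, mul_le_mul_of_nonneg_left h3 h0]
  rcases le_total θ 0.17 with h | h
  · refine ⟨0.282, one_sub_exp_neg_ge_small h0 h, ?_⟩
    have := exp_neg_tangent (k := 0.282) (c := 5 / 4) (P := P) (by norm_num)
      (by have := exp_five_quarter_lt; norm_num at this ⊢; linarith)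
    norm_num at *
    nlinarith
  · refine ⟨0.26 * (1 - θ), by
      have := one_sub_exp_neg_ge_quadratic h h1
      linarith, ?_⟩
    have := exp_neg_tangent (k := 0.26 * (1 - θ)) (c := 3 / 2) (P := P)
      (mul_nonneg (by norm_num) (by linarith))
      (by
        have h4 := exp_three_half_lt
        have h5 : 0.26 * (1 - θ) ≤ 0.2158 := by norm_num at h ⊢; linarith
        have := mul_le_mul h5 h4.le (Real.exp_pos _).le (by norm_num)
        refine this.trans (by norm_num))
    norm_num at *
    nlinarith

/-- The bound `(1 - 1/e) ((1 - θ) a + θ M)` follows from the subsolution started at the empty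
set, for one of the two natural choices of the coefficient `c`. -/
lemma exists_coefficient {θ P M a : ℝ} (h0 : 0 < θ) (h1 : θ ≤ 1) (hP : θ ≤ P) (ha : 0 ≤ a)
    (hM : a ≤ M) :
    ∃ c, (c * (P - θ) ≤ 0 ∨ c * (P - θ) ≤ P * a - θ * M) ∧
      (1 - Real.exp (-1)) * ((1 - θ) * a + θ * M)
        ≤ M * (1 - Real.exp (-θ)) + c * Real.exp (-θ) + (a - c) * Real.exp (-P) := by
  have hk := kink_inequality h0.le h1 (h0.le.trans hP)
  have hc := one_sub_exp_neg_ge_chord h0.le h1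
  have hEpos := Real.exp_pos (-1)
  rcases le_or_gt (P * a) (θ * M) with h | h
  · refine ⟨0, Or.inl (by simp), ?_⟩
    have key : θ * ((1 - Real.exp (-1)) * ((1 - θ) * a + θ * M))
        ≤ θ * (M * (1 - Real.exp (-θ)) + a * Real.exp (-P)) := by
      nlinarith [mul_le_mul_of_nonneg_right h (sub_nonneg.2 hc), mul_le_mul_of_nonneg_left hk ha]
    have := le_of_mul_le_mul_left key h0
    linarith
  · have hPθ : 0 < P - θ := by
      by_contra hle
      have : P = θ := by linarith
      rw [this] at h
      nlinarith [mul_le_mul_of_nonneg_left hM h0.le]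
    refine ⟨(P * a - θ * M) / (P - θ), Or.inr (by rw [div_mul_cancel₀ _ hPθ.ne']), ?_⟩
    set c := (P * a - θ * M) / (P - θ) with hcdef
    have hcP : c * (P - θ) = P * a - θ * M := by rw [hcdef, div_mul_cancel₀ _ hPθ.ne']
    have hc0 : 0 ≤ c := div_nonneg (by linarith) hPθ.le
    have hca : 0 ≤ a - c := by
      have : (a - c) * (P - θ) = θ * (M - a) := by linarith
      by_contra hneg
      push Not at hneg
      nlinarith [mul_nonneg h0.le (sub_nonneg.2 hM), mul_pos (neg_pos.2 hneg) hPθ]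
    have hMe : θ * M = P * (a - c) + θ * c := by linarith
    have key : θ * ((1 - Real.exp (-1)) * ((1 - θ) * a + θ * M))
        ≤ θ * (M * (1 - Real.exp (-θ)) + c * Real.exp (-θ) + (a - c) * Real.exp (-P)) := by
      have e1 : θ * (M * (1 - Real.exp (-θ)) + c * Real.exp (-θ) + (a - c) * Real.exp (-P))
          = (a - c) * (θ * Real.exp (-P) + P * (1 - Real.exp (-θ))) + θ * c := by
        linear_combination (1 - Real.exp (-θ)) * hMe
      have e2 : θ * ((1 - Real.exp (-1)) * ((1 - θ) * a + θ * M))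
          = (a - c) * ((1 - Real.exp (-1)) * θ * (1 + P - θ)) + θ * c * (1 - Real.exp (-1)) := by
        linear_combination (1 - Real.exp (-1)) * θ * hMe
      rw [e1, e2]
      have := mul_le_mul_of_nonneg_left hk hca
      nlinarith [mul_nonneg (mul_nonneg h0.le hc0) hEpos.le]
    exact le_of_mul_le_mul_left key h0

/-- Expected value of `f (S ∪ R)`, where `R` is the set of elements whose independent exponential
clocks with rates `p i` have rung before time `t`. -/
noncomputable def clockExp {V : Type*} [Fintype V] [DecidableEq V] (p : V → ℝ)
    (f : Finset V → ℝ) (S : Finset V) (t : ℝ) : ℝ :=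
  bernExp univ (fun i => 1 - Real.exp (-(p i * t))) (fun T => f (S ∪ T))

lemma clockExp_zero {V : Type*} [Fintype V] [DecidableEq V] (p : V → ℝ)
    (f : Finset V → ℝ) (S : Finset V) : clockExp p f S 0 = f S := by
  simp [clockExp, bernExp_zero]

lemma hasDerivAt_clockExp {V : Type*} [Fintype V] [DecidableEq V] (p : V → ℝ)
    (f : Finset V → ℝ) (S : Finset V) (t : ℝ) :
    HasDerivAt (clockExp p f S)
      (∑ j ∈ univ \ S, p j * clockExp p f (insert j S) t
        - (∑ j ∈ univ \ S, p j) * clockExp p f S t) t := by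
  refine (hasDerivAt_bernExp univ p (fun T => f (S ∪ T)) t).congr_deriv ?_
  rw [Finset.sum_mul, ← Finset.sum_sub_distrib]
  symm
  refine Finset.sum_subset_zero_on_sdiff (Finset.subset_univ _) (fun j hj => ?_) fun j _ => ?_
  · have hjS : j ∈ S := by simpa using hj
    have : ∀ T, S ∪ insert j T = S ∪ T := fun T => by
      rw [Finset.union_insert, Finset.insert_eq_self]
      exact Finset.mem_union_left _ hjS
    simp [this]
  · simp only [clockExp, Finset.union_insert, Finset.insert_union]
    ring

lemma clockExp_one_le_indepVal {V : Type*} [Fintype V] [DecidableEq V] {p : V → ℝ}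
    (hp : ∀ i, 0 ≤ p i ∧ p i ≤ 1) {f : Finset V → ℝ} (hmono : Monotone f) :
    clockExp p f ∅ 1 ≤ indepVal p f := by
  rw [indepVal_eq_bernExp, clockExp]
  simp only [Finset.empty_union, mul_one]
  refine bernExp_mono_left univ (fun i => ⟨?_, ?_⟩) hp (fun i => ?_) hmono
  · have : Real.exp (-p i) ≤ 1 := Real.exp_le_one_iff.2 (by linarith [(hp i).1])
    linarith
  · linarith [Real.exp_pos (-p i)]
  · linarith [Real.add_one_le_exp (-p i)]

lemma hasDerivAt_relaxation (M c θ t : ℝ) :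
    HasDerivAt (fun t => M * (1 - Real.exp (-(θ * t))) + c * Real.exp (-(θ * t)))
      (θ * (M - c) * Real.exp (-(θ * t))) t := by
  have h : HasDerivAt (fun t => -(θ * t)) (-θ) t := by
    simpa using ((hasDerivAt_id' t).const_mul θ).fun_neg
  refine (((h.exp.const_sub 1).const_mul M).add (h.exp.const_mul c)).congr_deriv ?_
  ring

lemma relaxation_le_clockExp {V : Type*} [Fintype V] [DecidableEq V] {p : V → ℝ}
    (hp : ∀ i, 0 ≤ p i) {f : Finset V → ℝ} {χ : List V → V → ℝ} {η θ M : ℝ}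
    (hsum : ∀ l : List V, l ≠ [] → l.Nodup → arrivalCost χ l ≤ η * f l.toFinset)
    (hdrift : ∀ l : List V, l.Nodup →
      θ * M - θ * arrivalCost χ l ≤ ∑ i ∈ univ \ l.toFinset, p i * χ (l ++ [i]) i)
    (l : List V) (hne : l ≠ []) (hl : l.Nodup) (t : ℝ) (ht : 0 ≤ t) :
    M * (1 - Real.exp (-(θ * t))) + arrivalCost χ l * Real.exp (-(θ * t))
      ≤ η * clockExp p f l.toFinset t := by
  induction hn : Fintype.card V - l.length using Nat.strong_induction_on generalizing l t with
  | _ n ih =>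
    refine le_of_linear_ode
      (v := fun t => η * clockExp p f l.toFinset t)
      (s := fun t => ∑ j ∈ univ \ l.toFinset, p j * (η * clockExp p f (insert j l.toFinset) t))
      (q := ∑ j ∈ univ \ l.toFinset, p j) (fun t => ?_)
      (hasDerivAt_relaxation M (arrivalCost χ l) θ) (fun t ht => ?_) ?_ t ht
    · refine ((hasDerivAt_clockExp p f l.toFinset t).const_mul η).congr_deriv ?_
      rw [mul_sub, Finset.mul_sum]
      congr 1
      · exact Finset.sum_congr rfl fun j _ => by ring
      · ring
    · have h1 : ∑ j ∈ univ \ l.toFinset, p j * (M * (1 - Real.exp (-(θ * t)))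
            + arrivalCost χ (l ++ [j]) * Real.exp (-(θ * t)))
          ≤ ∑ j ∈ univ \ l.toFinset, p j * (η * clockExp p f (insert j l.toFinset) t) := by
        refine Finset.sum_le_sum fun j hj => mul_le_mul_of_nonneg_left ?_ (hp j)
        have hjl : j ∉ l := by simpa using hj
        have hnd : (l ++ [j]).Nodup := by
          rw [List.nodup_append]
          refine ⟨hl, List.nodup_singleton j, ?_⟩
          rintro a ha b hb rfl
          exact hjl (by simpa using (List.mem_singleton.1 hb) ▸ ha)
        have hcard : l.length + 1 ≤ Fintype.card V := by simpa using hnd.length_le_card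
        have := ih (Fintype.card V - (l ++ [j]).length) (by simp; omega) (l ++ [j]) (by simp)
          hnd t ht rfl
        have hset : (l ++ [j]).toFinset = insert j l.toFinset := by ext; simp
        rwa [hset] at this
      have h2 : ∑ j ∈ univ \ l.toFinset, p j * (M * (1 - Real.exp (-(θ * t)))
            + arrivalCost χ (l ++ [j]) * Real.exp (-(θ * t)))
          = (∑ j ∈ univ \ l.toFinset, p j) * (M * (1 - Real.exp (-(θ * t)))
              + arrivalCost χ l * Real.exp (-(θ * t)))
            + (∑ j ∈ univ \ l.toFinset, p j * χ (l ++ [j]) j) * Real.exp (-(θ * t)) := by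
        rw [Finset.sum_mul, Finset.sum_mul, ← Finset.sum_add_distrib]
        refine Finset.sum_congr rfl fun j _ => ?_
        rw [arrivalCost_append_singleton]
        ring
      have h3 := mul_le_mul_of_nonneg_right (hdrift l hl) (Real.exp_pos (-(θ * t))).le
      linarith
    · simpa [clockExp_zero] using hsum l hne hl

lemma subsolution_le_clockExp_empty {V : Type*} [Fintype V] [DecidableEq V] {p : V → ℝ}
    (hp : ∀ i, 0 ≤ p i) {f : Finset V → ℝ} {χ : List V → V → ℝ} {η θ M a c : ℝ}
    (hsum : ∀ l : List V, l ≠ [] → l.Nodup → arrivalCost χ l ≤ η * f l.toFinset)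
    (hdrift : ∀ l : List V, l.Nodup →
      θ * M - θ * arrivalCost χ l ≤ ∑ i ∈ univ \ l.toFinset, p i * χ (l ++ [i]) i)
    (ha : a ≤ η * f ∅) (hsingle : ∀ i, a ≤ χ [i] i)
    (hc : c * (∑ i, p i - θ) ≤ 0 ∨ c * (∑ i, p i - θ) ≤ (∑ i, p i) * a - θ * M) :
    M * (1 - Real.exp (-θ)) + c * Real.exp (-θ) + (a - c) * Real.exp (-∑ i, p i)
      ≤ η * clockExp p f ∅ 1 := by
  set P := ∑ i, p i with hP
  have hs : ∀ j, arrivalCost χ [j] = χ [j] j := fun j => by simp [arrivalCost]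
  have hshare : c * (P - θ) + θ * M ≤ ∑ j, p j * χ [j] j := by
    rcases hc with hc | hc
    · have := hdrift [] List.nodup_nil
      simp [arrivalCost] at this
      linarith
    · have : P * a ≤ ∑ j, p j * χ [j] j := by
        rw [hP, Finset.sum_mul]
        exact Finset.sum_le_sum fun j _ => mul_le_mul_of_nonneg_left (hsingle j) (hp j)
      linarith
  have hyd : ∀ t, HasDerivAt (fun t => (M * (1 - Real.exp (-(θ * t))) + c * Real.exp (-(θ * t)))
      + (0 * (1 - Real.exp (-(P * t))) + (a - c) * Real.exp (-(P * t))))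
      (θ * (M - c) * Real.exp (-(θ * t)) + P * (0 - (a - c)) * Real.exp (-(P * t))) t := fun t =>
    (hasDerivAt_relaxation M c θ t).add (hasDerivAt_relaxation 0 (a - c) P t)
  have := le_of_linear_ode (v := fun t => η * clockExp p f ∅ t)
      (s := fun t => ∑ j, p j * (η * clockExp p f {j} t)) (q := P) (fun t => ?_) hyd
      (fun t ht => ?_) ?_ 1 zero_le_one
  · simpa using this
  · refine ((hasDerivAt_clockExp p f ∅ t).const_mul η).congr_deriv ?_
    simp only [Finset.sdiff_empty, insert_empty_eq]
    rw [mul_sub, Finset.mul_sum]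
    congr 1
    · exact Finset.sum_congr rfl fun j _ => by ring
    · ring
  · have h1 : ∑ j, p j * (M * (1 - Real.exp (-(θ * t))) + χ [j] j * Real.exp (-(θ * t)))
        ≤ ∑ j, p j * (η * clockExp p f {j} t) := by
      refine Finset.sum_le_sum fun j _ => mul_le_mul_of_nonneg_left ?_ (hp j)
      have := relaxation_le_clockExp hp hsum hdrift [j] (by simp) (List.nodup_singleton j) t ht
      rw [hs] at this
      simpa using this
    have h2 : ∑ j, p j * (M * (1 - Real.exp (-(θ * t))) + χ [j] j * Real.exp (-(θ * t)))
        = P * (M * (1 - Real.exp (-(θ * t)))) + (∑ j, p j * χ [j] j) * Real.exp (-(θ * t)) := by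
      rw [hP, Finset.sum_mul, Finset.sum_mul, ← Finset.sum_add_distrib]
      exact Finset.sum_congr rfl fun j _ => by ring
    have h3 := mul_le_mul_of_nonneg_right hshare (Real.exp_pos (-(θ * t))).le
    linarith
  · simpa [clockExp_zero] using ha

lemma le_indepVal_of_empty {V : Type*} [Fintype V] [DecidableEq V] {p : V → ℝ}
    (hp : ∀ i, 0 ≤ p i ∧ p i ≤ 1) {f : Finset V → ℝ} (hmono : Monotone f) :
    f ∅ ≤ indepVal p f := by
  rw [indepVal_eq_bernExp, ← bernExp_const univ p (f ∅)]
  exact bernExp_mono_right univ hp fun T => hmono (Finset.empty_subset T)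

/-- The correlation gap of a monotone function with an `(η, β)`-cost-sharing scheme is at most
`η β e / (e - 1)`. -/
lemma correlation_gap {V : Type*} [Fintype V] [DecidableEq V] {p : V → ℝ}
    (hp : ∀ i, 0 ≤ p i ∧ p i ≤ 1) {α : Finset V → ℝ} (hα : IsDistWithMarginals p α)
    {f : Finset V → ℝ} {η β : ℝ} (hη : 1 ≤ η) (hβ : 1 ≤ β) (hmono : Monotone f)
    (hf0 : 0 ≤ f ∅) {χ : List V → V → ℝ} (hχ : IsCostShare f η β χ) :
    (1 - Real.exp (-1)) * expVal α f ≤ η * β * indepVal p f := by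
  have hβ0 : 0 < β := by linarith
  set θ := ∑ A ∈ univ.erase ∅, α A with hθ
  set G := ∑ A ∈ univ.erase ∅, α A * (f A / β) with hG
  set a := f ∅ / β with ha
  have ha0 : 0 ≤ a := div_nonneg hf0 hβ0.le
  have hα0 : α ∅ = 1 - θ := by
    have := Finset.add_sum_erase univ α (Finset.mem_univ ∅)
    rw [hα.2.1] at this
    linarith
  have hθ0 : 0 ≤ θ := Finset.sum_nonneg fun A _ => hα.1 A
  have hθ1 : θ ≤ 1 := by linarith [hα.1 ∅]
  have hexp : expVal α f = β * ((1 - θ) * a + G) := by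
    rw [expVal, ← Finset.add_sum_erase univ _ (Finset.mem_univ ∅), hα0, mul_add, hG,
      Finset.mul_sum, ha]
    congr 1
    · field_simp
    · exact Finset.sum_congr rfl fun A _ => by field_simp
  have haG : θ * a ≤ G := by
    rw [hθ, hG, Finset.sum_mul]
    refine Finset.sum_le_sum fun A _ => mul_le_mul_of_nonneg_left ?_ (hα.1 A)
    exact div_le_div_of_nonneg_right (hmono (Finset.empty_subset A)) hβ0.le
  have hfa : f ∅ = β * a := by rw [ha]; field_simp
  have hI := le_indepVal_of_empty hp hmono
  have haη : a ≤ η * f ∅ := by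
    rw [hfa]
    nlinarith [mul_nonneg (sub_nonneg.2 hη) (mul_nonneg hβ0.le ha0),
      mul_nonneg (sub_nonneg.2 hβ) ha0]
  rcases hθ0.eq_or_lt with h0 | hpos
  · have hz : ∀ A ∈ univ.erase ∅, α A = 0 :=
      (Finset.sum_eq_zero_iff_of_nonneg fun A _ => hα.1 A).1 h0.symm
    have hG0 : G = 0 := Finset.sum_eq_zero fun A hA => by rw [hz A hA, zero_mul]
    rw [hexp, hG0, ← h0, sub_zero, one_mul, add_zero, ← hfa]
    have hE := Real.exp_pos (-1)
    have h1 : (1 - Real.exp (-1)) * f ∅ ≤ f ∅ := by nlinarith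
    have h2 : 1 ≤ η * β := by nlinarith
    nlinarith
  · set M := G / θ with hM
    have hθM : θ * M = G := by rw [hM]; field_simp
    have hPθ : θ ≤ ∑ i, p i := by
      have := sum_marginals hα univ (fun _ => 1)
      simp only [mul_one, Finset.inter_univ, Finset.sum_const, nsmul_eq_mul] at this
      rw [this, ← Finset.add_sum_erase univ _ (Finset.mem_univ ∅)]
      simp only [Finset.card_empty, Nat.cast_zero, mul_zero, zero_add]
      refine Finset.sum_le_sum fun A hA => le_mul_of_one_le_right (hα.1 A) ?_
      have : 0 < A.card :=
        Finset.card_pos.2 (Finset.nonempty_iff_ne_empty.2 (Finset.ne_of_mem_erase hA))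
      exact_mod_cast this
    have haM : a ≤ M := by rw [hM, le_div_iff₀ hpos]; linarith
    obtain ⟨c, hc, hle⟩ := exists_coefficient hpos hθ1 hPθ ha0 haM
    have hsub := subsolution_le_clockExp_empty (fun i => (hp i).1) hχ.2.2
      (θ := θ) (M := M) (fun l hl => by rw [hθM]; exact drift_le hα hβ hmono hχ hl) haη
      (fun i => by
        have h1 := (hχ.1 [i] (by simp) (List.nodup_singleton i)).2
        simp only [List.toFinset_cons, List.toFinset_nil, insert_empty_eq,
          Finset.sum_singleton] at h1
        exact (div_le_div_of_nonneg_right (hmono (Finset.empty_subset {i})) hβ0.le).trans h1) hc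
    have hv := mul_le_mul_of_nonneg_left (clockExp_one_le_indepVal hp hmono)
      (zero_le_one.trans hη)
    rw [hexp, ← hθM]
    have := mul_le_mul_of_nonneg_left ((hle.trans hsub).trans hv) hβ0.le
    linarith

lemma isDistWithMarginals_indep {V : Type*} [Fintype V] [DecidableEq V] {p : V → ℝ}
    (hp : ∀ i, 0 ≤ p i ∧ p i ≤ 1) :
    IsDistWithMarginals p (fun S => (∏ i ∈ S, p i) * (∏ i ∈ Sᶜ, (1 - p i))) := by
  refine ⟨fun S => mul_nonneg (Finset.prod_nonneg fun i _ => (hp i).1)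
    (Finset.prod_nonneg fun i _ => sub_nonneg.2 (hp i).2), ?_, fun i => ?_⟩
  · have := bernExp_const univ p 1
    rw [← indepVal_eq_bernExp] at this
    simpa [indepVal] using this
  · have h : indepVal p (fun S => if i ∈ S then 1 else 0) = p i := by
      rw [indepVal_eq_bernExp, ← Finset.insert_erase (Finset.mem_univ i),
        bernExp_insert (Finset.notMem_erase i univ)]
      have h0 : bernExp (univ.erase i) p (fun S => if i ∈ S then 1 else 0) = 0 := by
        refine Finset.sum_eq_zero fun T hT => ?_
        have : i ∉ T := fun hi => Finset.notMem_erase i univ (Finset.mem_powerset.1 hT hi)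
        simp [this]
      rw [h0]
      simp [bernExp_const]
    rw [Finset.sum_filter]
    simpa [indepVal] using h

lemma bddAbove_expVal {V : Type*} [Fintype V] [DecidableEq V] (p : V → ℝ)
    {f : Finset V → ℝ} (hmono : Monotone f) :
    BddAbove {v | ∃ α, IsDistWithMarginals p α ∧ v = expVal α f} := by
  refine ⟨f univ, ?_⟩
  rintro _ ⟨α, hα, rfl⟩
  calc expVal α f ≤ ∑ S, α S * f univ :=
        Finset.sum_le_sum fun S _ =>
          mul_le_mul_of_nonneg_left (hmono (Finset.subset_univ S)) (hα.1 S)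
    _ = f univ := by rw [← Finset.sum_mul, hα.2.1, one_mul]

lemma indepVal_le_worstVal {V : Type*} [Fintype V] [DecidableEq V] {p : V → ℝ}
    (hp : ∀ i, 0 ≤ p i ∧ p i ≤ 1) {f : Finset V → ℝ} (hmono : Monotone f) :
    indepVal p f ≤ worstVal p f :=
  le_csSup (bddAbove_expVal p hmono) ⟨_, isDistWithMarginals_indep hp, rfl⟩

/-- Corollary 1: solving the stochastic optimization problem under the independent
distribution yields an `ηβe/(e-1)`-approximate solution to the correlation-robust problem. -/
theorem robust_approx_via_independent
    {V : Type*} [Fintype V] [DecidableEq V] {X : Type*}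
    (p : V → ℝ) (hp : ∀ i, 0 ≤ p i ∧ p i ≤ 1)
    (C : Finset X) (hC : C.Nonempty)
    (f : X → Finset V → ℝ)
    (η β : ℝ) (hη : 1 ≤ η) (hβ : 1 ≤ β)
    (hmono : ∀ x ∈ C, ∀ S T : Finset V, S ⊆ T → f x S ≤ f x T)
    (hf0 : ∀ x ∈ C, 0 ≤ f x ∅)
    (hcs : ∀ x ∈ C, ∃ χ : List V → V → ℝ, IsCostShare (f x) η β χ)
    (xI : X) (hxI : xI ∈ C)
    (hIopt : ∀ x ∈ C, indepVal p (f xI) ≤ indepVal p (f x)) :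
    ∀ x ∈ C, worstVal p (f xI)
      ≤ η * β * (Real.exp 1 / (Real.exp 1 - 1)) * worstVal p (f x) := by
  intro x hx
  have hE : Real.exp 1 / (Real.exp 1 - 1) * (1 - Real.exp (-1)) = 1 := by
    have h1 : 1 < Real.exp 1 := Real.one_lt_exp_iff.2 one_pos
    have h2 : Real.exp 1 - 1 ≠ 0 := by linarith
    have h3 : Real.exp 1 * Real.exp (-1) = 1 := by rw [← Real.exp_add]; simp
    rw [div_mul_eq_mul_div, div_eq_one_iff_eq h2]
    linear_combination -h3
  have hpos : 0 ≤ Real.exp 1 / (Real.exp 1 - 1) :=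
    div_nonneg (Real.exp_pos 1).le (by linarith [Real.one_lt_exp_iff.2 (one_pos (α := ℝ))])
  have hηβ : 0 ≤ η * β := mul_nonneg (by linarith) (by linarith)
  obtain ⟨χ, hχ⟩ := hcs xI hxI
  have hI : indepVal p (f xI) ≤ worstVal p (f x) :=
    (hIopt x hx).trans (indepVal_le_worstVal hp fun S T h => hmono x hx S T h)
  refine csSup_le ⟨_, _, isDistWithMarginals_indep hp, rfl⟩ ?_
  rintro _ ⟨α, hα, rfl⟩
  have hgap := correlation_gap hp hα hη hβ (fun S T h => hmono xI hxI S T h) (hf0 xI hxI) hχ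
  calc expVal α (f xI)
      = Real.exp 1 / (Real.exp 1 - 1) * ((1 - Real.exp (-1)) * expVal α (f xI)) := by
        rw [← mul_assoc, hE, one_mul]
    _ ≤ Real.exp 1 / (Real.exp 1 - 1) * (η * β * indepVal p (f xI)) :=
        mul_le_mul_of_nonneg_left hgap hpos
    _ ≤ Real.exp 1 / (Real.exp 1 - 1) * (η * β * worstVal p (f x)) :=
        mul_le_mul_of_nonneg_left (mul_le_mul_of_nonneg_left hI hηβ) hpos
    _ = η * β * (Real.exp 1 / (Real.exp 1 - 1)) * worstVal p (f x) := by ring
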